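/- For every n with n ∈ U and every x ∈ ℕ, it is not the case that both x E n and x NE n hold; i.e., elementhood and non-elementhood in any type of U are disjoint. -/

import Mathlib

/-- The tuple coding `⟨m₁,…,m_k⟩ := p₁^{m₁+1} ⋯ p_k^{m_k+1}` (`p_i` the `i`-th prime),
with `⟨⟩ = 1`. -/
noncomputable def code (l : List ℕ) : ℕ :=
  ∏ i ∈ Finset.range l.length, (Nat.nth Nat.Prime i) ^ (l.getD i 0 + 1)

/-- `CompClosed Sb0 X` says that the set `X ⊆ ℕ` is closed under the clauses of
Definition 4.1 (recursion in the type-2 functional `E`), relative to a fixed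
S-m-n substitution function `Sb0`. -/
def CompClosed (Sb0 : ℕ → ℕ → ℕ) (X : Set ℕ) : Prop :=
  (∀ (k n : ℕ) (m : List ℕ), m.length = k →
      code (code [0, k, 0, n] :: m ++ [n]) ∈ X) ∧
  (∀ (k i : ℕ) (m : List ℕ), m.length = k → i < k →
      code (code [0, k, 1, i] :: m ++ [m.getD i 0]) ∈ X) ∧
  (∀ (k i : ℕ) (m : List ℕ), m.length = k → i < k →
      code (code [0, k, 2, i] :: m ++ [m.getD i 0 + 1]) ∈ X) ∧
  (∀ (k p q r s : ℕ) (m : List ℕ), m.length = k → r = s →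
      code (code [0, k + 3, 4] :: p :: q :: r :: s :: m ++ [p]) ∈ X) ∧
  (∀ (k p q r s : ℕ) (m : List ℕ), m.length = k → r ≠ s →
      code (code [0, k + 3, 4] :: p :: q :: r :: s :: m ++ [q]) ∈ X) ∧
  (∀ (k p q : ℕ) (m : List ℕ), m.length = k →
      code (code [0, k + 2, 5] :: p :: q :: m ++ [Sb0 p q]) ∈ X) ∧
  (∀ (k k' b n : ℕ) (m c q : List ℕ), m.length = k → c.length = k' → q.length = k' →
      (∀ i < k', code (c.getD i 0 :: m ++ [q.getD i 0]) ∈ X) →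
      code (b :: q ++ [n]) ∈ X →
      code (code ([1, k, b] ++ c) :: m ++ [n]) ∈ X) ∧
  (∀ (k b n : ℕ) (m : List ℕ), m.length = k →
      code (b :: m ++ [n]) ∈ X →
      code (code [2, k + 1] :: b :: m ++ [n]) ∈ X) ∧
  (∀ (k b : ℕ) (m : List ℕ), m.length = k →
      (∀ p : ℕ, ∃ kp : ℕ, 0 < kp ∧ code (b :: p :: m ++ [kp]) ∈ X) →
      code (code [3, k, b] :: m ++ [0]) ∈ X) ∧
  (∀ (k b p : ℕ) (m : List ℕ), m.length = k →
      code (b :: p :: m ++ [0]) ∈ X →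
      (∀ i < p, ∃ ki : ℕ, 0 < ki ∧ code (b :: i :: m ++ [ki]) ∈ X) →
      code (code [3, k, b] :: m ++ [p + 1]) ∈ X)

/-- `Comp Sb0` is the smallest set closed under the clauses of Definition 4.1. -/
def Comp (Sb0 : ℕ → ℕ → ℕ) : Set ℕ :=
  {u : ℕ | ∀ X : Set ℕ, CompClosed Sb0 X → u ∈ X}

/-- The pairing function `(n, m) := (n + m)² + n + 1`. -/
def pair (n m : ℕ) : ℕ := (n + m) ^ 2 + n + 1

/-- `n_ℕ := (0, n)`, the code of the finite type with `n` elements. -/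
def nNat (n : ℕ) : ℕ := pair 0 n

/-- `nat := (1, 0)`, the code of the type of natural numbers. -/
def natt : ℕ := pair 1 0

/-- `pl(n, m) := (2, (n, m))`, the code of a sum type. -/
def plT (n m : ℕ) : ℕ := pair 2 (pair n m)

/-- `σ(n, e) := (3, (n, e))`, the code of a dependent sum type. -/
def sigT (n e : ℕ) : ℕ := pair 3 (pair n e)

/-- `π(n, e) := (4, (n, e))`, the code of a dependent product type. -/
def piT (n e : ℕ) : ℕ := pair 4 (pair n e)

/-- `sup(n, e) := (5, (n, e))`, the code of a well-founded tree. -/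
def supT (n e : ℕ) : ℕ := pair 5 (pair n e)

/-- `{e}^E(k) ≃ x`, i.e. `⟨e, k, x⟩ ∈ Comp`. -/
def app (Sb0 : ℕ → ℕ → ℕ) (e k x : ℕ) : Prop := code [e, k, x] ∈ Comp Sb0

/-- A family of predicates: candidate interpretations for the type predicate `U`,
the elementhood predicate `E`, the non-elementhood predicate `NE`, and the
predicate `V` of codes of well-founded trees over `U`. -/
structure TyFam where
  U : ℕ → Prop
  E : ℕ → ℕ → Prop
  NE : ℕ → ℕ → Prop
  V : ℕ → Prop

/-- `TyClosed Sb0 F` says the family `F` is closed under the clauses of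
Definition 5.2 defining the types `U`, elementhood `E`, non-elementhood `NE`
and the class `V` of well-founded trees. -/
def TyClosed (Sb0 : ℕ → ℕ → ℕ) (F : TyFam) : Prop :=
  (∀ n : ℕ, F.U (nNat n)) ∧
  (∀ k n : ℕ, k < n → F.E k (nNat n)) ∧
  (∀ k n : ℕ, n ≤ k → F.NE k (nNat n)) ∧
  F.U natt ∧
  (∀ n : ℕ, F.E n natt) ∧
  (∀ n m : ℕ, F.U n → F.U m → F.U (plT n m)) ∧
  (∀ n m k : ℕ, F.U (plT n m) → F.E k n → F.E (pair 0 k) (plT n m)) ∧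
  (∀ n m k : ℕ, F.U (plT n m) → F.E k m → F.E (pair 1 k) (plT n m)) ∧
  (∀ n m k : ℕ, F.U (plT n m) → F.NE k n → F.NE (pair 0 k) (plT n m)) ∧
  (∀ n m k : ℕ, F.U (plT n m) → F.NE k m → F.NE (pair 1 k) (plT n m)) ∧
  (∀ n m k : ℕ, F.U (plT n m) → (∀ x : ℕ, k ≠ pair 0 x ∧ k ≠ pair 1 x) →
      F.NE k (plT n m)) ∧
  (∀ n e : ℕ, F.U n → (∀ k : ℕ, F.NE k n ∨ ∃ x : ℕ, app Sb0 e k x ∧ F.U x) →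
      F.U (sigT n e)) ∧
  (∀ n e k u x : ℕ, F.U (sigT n e) → F.E k n → app Sb0 e k x → F.E u x →
      F.E (pair k u) (sigT n e)) ∧
  (∀ n e k u : ℕ, F.U (sigT n e) → F.NE k n → F.NE (pair k u) (sigT n e)) ∧
  (∀ n e k u x : ℕ, F.U (sigT n e) → app Sb0 e k x → F.NE u x →
      F.NE (pair k u) (sigT n e)) ∧
  (∀ n e z : ℕ, F.U (sigT n e) → (∀ u v : ℕ, z ≠ pair u v) → F.NE z (sigT n e)) ∧
  (∀ n e : ℕ, F.U n → (∀ k : ℕ, F.NE k n ∨ ∃ x : ℕ, app Sb0 e k x ∧ F.U x) →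
      F.U (piT n e)) ∧
  (∀ n e d : ℕ, F.U (piT n e) →
      (∀ k : ℕ, F.NE k n ∨ ∃ x y : ℕ, app Sb0 e k x ∧ app Sb0 d k y ∧ F.E y x) →
      F.E d (piT n e)) ∧
  (∀ n e d u : ℕ, F.U (piT n e) → F.E u n → (∀ z : ℕ, ¬ app Sb0 d u z) →
      F.NE d (piT n e)) ∧
  (∀ n e d u x z : ℕ, F.U (piT n e) → F.E u n → app Sb0 e u x → app Sb0 d u z →
      F.NE z x → F.NE d (piT n e)) ∧
  (∀ n e : ℕ, F.U n → (∀ k : ℕ, F.NE k n ∨ ∃ x : ℕ, app Sb0 e k x ∧ F.V x) →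
      F.V (supT n e))

/-- The type predicate `U`: smallest family closed under the clauses of Definition 5.2. -/
def UU (Sb0 : ℕ → ℕ → ℕ) (n : ℕ) : Prop := ∀ F : TyFam, TyClosed Sb0 F → F.U n

/-- The elementhood predicate `k E n` of Definition 5.2. -/
def EE (Sb0 : ℕ → ℕ → ℕ) (k n : ℕ) : Prop := ∀ F : TyFam, TyClosed Sb0 F → F.E k n

/-- The non-elementhood predicate `k NE n` of Definition 5.2. -/
def NEE (Sb0 : ℕ → ℕ → ℕ) (k n : ℕ) : Prop := ∀ F : TyFam, TyClosed Sb0 F → F.NE k n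

/-- The predicate `V` of codes of well-founded trees over `U` of Definition 5.2. -/
def VV (Sb0 : ℕ → ℕ → ℕ) (n : ℕ) : Prop := ∀ F : TyFam, TyClosed Sb0 F → F.V n

theorem code_fact (l : List ℕ) (i : ℕ) :
    (code l).factorization (Nat.nth Nat.Prime i) = if i < l.length then l.getD i 0 + 1 else 0 := by
  have hp : ∀ j, (Nat.nth Nat.Prime j).Prime := fun j => Nat.prime_nth_prime j
  have hinj : Function.Injective (Nat.nth Nat.Prime) :=
    Nat.nth_injective Nat.infinite_setOfPred_prime
  unfold code
  rw [Nat.factorization_prod_apply (fun j _ => pow_ne_zero _ (hp j).ne_zero)]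
  have : ∀ j ∈ Finset.range l.length,
      ((Nat.nth Nat.Prime j) ^ (l.getD j 0 + 1)).factorization (Nat.nth Nat.Prime i)
        = if i = j then l.getD j 0 + 1 else 0 := by
    intro j _
    rw [(hp j).factorization_pow, Finsupp.single_apply]
    simp only [hinj.eq_iff, eq_comm]
  rw [Finset.sum_congr rfl this, Finset.sum_ite_eq]
  simp

theorem code_inj {l l' : List ℕ} : code l = code l' ↔ l = l' := by
  refine ⟨fun h => ?_, fun h => h ▸ rfl⟩
  have key : ∀ i, (if i < l.length then l.getD i 0 + 1 else 0)
      = (if i < l'.length then l'.getD i 0 + 1 else 0) := by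
    intro i
    rw [← code_fact, ← code_fact, h]
  have hlen : l.length = l'.length := by
    have h1 := key l.length
    have h2 := key l'.length
    split_ifs at h1 h2 <;> omega
  apply List.ext_getElem hlen
  intro i h1 h2
  have := key i
  simp only [h1, h2, if_true] at this
  rw [List.getD_eq_getElem _ _ h1, List.getD_eq_getElem _ _ h2] at this
  omega

/-- Inductive version of `Comp`. -/
inductive IC (Sb0 : ℕ → ℕ → ℕ) : ℕ → List ℕ → ℕ → Prop
  | c0 (k n m) : IC Sb0 (code [0, k, 0, n]) m n
  | c1 (k i m) : IC Sb0 (code [0, k, 1, i]) m (m.getD i 0)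
  | c2 (k i m) : IC Sb0 (code [0, k, 2, i]) m (m.getD i 0 + 1)
  | c4 (k p q r s m) : r = s → IC Sb0 (code [0, k + 3, 4]) (p :: q :: r :: s :: m) p
  | c4' (k p q r s m) : r ≠ s → IC Sb0 (code [0, k + 3, 4]) (p :: q :: r :: s :: m) q
  | c5 (k p q m) : IC Sb0 (code [0, k + 2, 5]) (p :: q :: m) (Sb0 p q)
  | comp (k b n : ℕ) (m c q : List ℕ) : q.length = c.length →
      (∀ i < c.length, IC Sb0 (c.getD i 0) m (q.getD i 0)) → IC Sb0 b q n →
      IC Sb0 (code ([1, k, b] ++ c)) m n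
  | univ (k b n m) : IC Sb0 b m n → IC Sb0 (code [2, k + 1]) (b :: m) n
  | e1 (k b m) (f : ℕ → ℕ) : (∀ p, 0 < f p) → (∀ p, IC Sb0 b (p :: m) (f p)) →
      IC Sb0 (code [3, k, b]) m 0
  | e2 (k b p m) (f : ℕ → ℕ) : IC Sb0 b (p :: m) 0 → (∀ i < p, 0 < f i) →
      (∀ i < p, IC Sb0 b (i :: m) (f i)) → IC Sb0 (code [3, k, b]) m (p + 1)

theorem IC.fun {Sb0 e m n} (h : IC Sb0 e m n) : ∀ n', IC Sb0 e m n' → n' = n := by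
  induction h with
  | c0 k n m =>
    intro n' h'; generalize h1 : code _ = t at h'
    cases h' <;> simp_all [code_inj]
  | c1 k i m =>
    intro n' h'; generalize h1 : code _ = t at h'
    cases h' <;> simp_all [code_inj]
  | c2 k i m =>
    intro n' h'; generalize h1 : code _ = t at h'
    cases h' <;> simp_all [code_inj]
  | c4 k p q r s m hrs =>
    intro n' h'; generalize h1 : code _ = t at h'
    cases h' <;> simp_all [code_inj]
  | c4' k p q r s m hrs =>
    intro n' h'; generalize h1 : code _ = t at h'
    cases h' <;> simp_all [code_inj]
  | c5 k p q m =>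
    intro n' h'; generalize h1 : code _ = t at h'
    cases h' <;> simp_all [code_inj]
  | comp k b n m c q hl h1 h2 ih1 ih2 =>
    intro n' h'; generalize he : code _ = t at h'
    cases h' with
    | comp k' b' _ _ c' q' hl' h1' h2' =>
      simp only [code_inj, List.cons_append, List.nil_append, List.cons.injEq, true_and] at he
      obtain ⟨rfl, rfl, rfl⟩ := he
      have : q' = q := by
        apply List.ext_getElem (by omega)
        intro i g1 g2
        have := ih1 i (by omega) _ (h1' i (by omega))
        rwa [List.getD_eq_getElem _ _ g1, List.getD_eq_getElem _ _ g2] at this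
      subst this
      exact ih2 _ h2'
    | _ => simp [code_inj] at he
  | univ k b n m h ih =>
    intro n' h'; generalize he : code _ = t at h'
    cases h' with
    | univ _ _ _ _ h' => exact ih _ h'
    | _ => simp [code_inj] at he
  | e1 k b m f hf h ih =>
    intro n' h'; generalize he : code _ = t at h'
    cases h' with
    | e1 => rfl
    | e2 k' b' p m f' h0 hf' h' =>
      simp [code_inj] at he
      obtain ⟨rfl, rfl⟩ := he
      have := ih _ _ h0
      have := hf p
      omega
    | _ => simp [code_inj] at he
  | e2 k b p m f h0 hf h ih0 ih =>
    intro n' h'; generalize he : code _ = t at h'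
    cases h' with
    | e1 k' b' m f' hf' h' =>
      simp [code_inj] at he
      obtain ⟨rfl, rfl⟩ := he
      have := ih0 _ (h' p)
      have := hf' p
      omega
    | e2 k' b' p' m f' h0' hf' h' =>
      simp [code_inj] at he
      obtain ⟨rfl, rfl⟩ := he
      rcases lt_trichotomy p p' with g | g | g
      · have := ih0 _ (h' p g)
        have := hf' p g
        omega
      · rw [g]
      · have := ih _ g _ h0'
        have := hf _ g
        omega
    | _ => simp [code_inj] at he

/-- The set of computations described by `IC`. -/
def ICset (Sb0 : ℕ → ℕ → ℕ) : Set ℕ := {u | ∀ e m n, u = code (e :: m ++ [n]) → IC Sb0 e m n}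

theorem mem_ICset {Sb0 : ℕ → ℕ → ℕ} {e m n} : code (e :: m ++ [n]) ∈ ICset Sb0 ↔ IC Sb0 e m n := by
  refine ⟨fun h => h _ _ _ rfl, fun h e' m' n' he => ?_⟩
  rw [code_inj, List.cons_append, List.cons_append, List.cons.injEq] at he
  obtain ⟨rfl, h2⟩ := he
  obtain ⟨rfl, h3⟩ := List.append_inj' h2 rfl
  simp at h3
  subst h3
  exact h

theorem closed_ICset (Sb0 : ℕ → ℕ → ℕ) : CompClosed Sb0 (ICset Sb0) := by
  refine ⟨?_, ?_, ?_, ?_, ?_, ?_, ?_, ?_, ?_, ?_⟩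
  · intro k n m _; exact mem_ICset.2 (.c0 _ _ _)
  · intro k n m _ _; exact mem_ICset.2 (.c1 _ _ _)
  · intro k n m _ _; exact mem_ICset.2 (.c2 _ _ _)
  · intro k p q r s m _ h; exact (mem_ICset (m := p :: q :: r :: s :: m)).2 (.c4 _ _ _ _ _ _ h)
  · intro k p q r s m _ h; exact (mem_ICset (m := p :: q :: r :: s :: m)).2 (.c4' _ _ _ _ _ _ h)
  · intro k p q m _; exact (mem_ICset (m := p :: q :: m)).2 (.c5 _ _ _ _)
  · intro k k' b n m c q _ hc hq h1 h2
    subst hc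
    exact mem_ICset.2 (.comp _ _ _ _ _ q hq (fun i hi => mem_ICset.1 (h1 i hi)) (mem_ICset.1 h2))
  · intro k b n m _ h; exact (mem_ICset (m := b :: m)).2 (.univ _ _ _ _ (mem_ICset.1 h))
  · intro k b m _ h
    choose f hf h using h
    exact mem_ICset.2 (.e1 _ _ _ f hf fun p => (mem_ICset (m := p :: m)).1 (h p))
  · intro k b p m _ h0 h
    have : ∀ i, ∃ ki : ℕ, i < p → 0 < ki ∧ code (b :: i :: m ++ [ki]) ∈ ICset Sb0 := by
      intro i
      by_cases hi : i < p
      · obtain ⟨x, hx⟩ := h i hi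
        exact ⟨x, fun _ => hx⟩
      · exact ⟨0, fun h => absurd h hi⟩
    choose f hf using this
    exact mem_ICset.2 (.e2 _ _ _ _ f ((mem_ICset (m := p :: m)).1 h0) (fun i hi => (hf i hi).1)
      fun i hi => (mem_ICset (m := i :: m)).1 (hf i hi).2)

theorem app_fun {Sb0 : ℕ → ℕ → ℕ} {e k x y} (h : app Sb0 e k x) (h' : app Sb0 e k y) : y = x :=
  ((mem_ICset (m := [k])).1 (h _ (closed_ICset Sb0))).fun _
    ((mem_ICset (m := [k])).1 (h' _ (closed_ICset Sb0)))

theorem pair_inj {a b c d : ℕ} : pair a b = pair c d ↔ a = c ∧ b = d := by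
  refine ⟨fun h => ?_, fun h => by rw [h.1, h.2]⟩
  unfold pair at h
  have : a + b = c + d := by
    rcases lt_trichotomy (a + b) (c + d) with g | g | g
    · nlinarith
    · exact g
    · nlinarith
  rw [this] at h
  omega

mutual
/-- Inductive version of `UU`. -/
inductive IU (Sb0 : ℕ → ℕ → ℕ) : ℕ → Prop
  | fin (n) : IU Sb0 (nNat n)
  | nat : IU Sb0 natt
  | pl (n m) : IU Sb0 n → IU Sb0 m → IU Sb0 (plT n m)
  | sig (n e) (S : Set ℕ) (f : ℕ → ℕ) : IU Sb0 n → (∀ k ∈ S, INE Sb0 k n) →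
      (∀ k ∉ S, app Sb0 e k (f k)) → (∀ k ∉ S, IU Sb0 (f k)) → IU Sb0 (sigT n e)
  | pi (n e) (S : Set ℕ) (f : ℕ → ℕ) : IU Sb0 n → (∀ k ∈ S, INE Sb0 k n) →
      (∀ k ∉ S, app Sb0 e k (f k)) → (∀ k ∉ S, IU Sb0 (f k)) → IU Sb0 (piT n e)
/-- Inductive version of `EE`. -/
inductive IE (Sb0 : ℕ → ℕ → ℕ) : ℕ → ℕ → Prop
  | fin (k n) : k < n → IE Sb0 k (nNat n)
  | nat (n) : IE Sb0 n natt
  | pl0 (n m k) : IU Sb0 (plT n m) → IE Sb0 k n → IE Sb0 (pair 0 k) (plT n m)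
  | pl1 (n m k) : IU Sb0 (plT n m) → IE Sb0 k m → IE Sb0 (pair 1 k) (plT n m)
  | sig (n e k u x) : IU Sb0 (sigT n e) → IE Sb0 k n → app Sb0 e k x → IE Sb0 u x →
      IE Sb0 (pair k u) (sigT n e)
  | pi (n e d) (S : Set ℕ) (f g : ℕ → ℕ) : IU Sb0 (piT n e) → (∀ k ∈ S, INE Sb0 k n) →
      (∀ k ∉ S, app Sb0 e k (f k)) → (∀ k ∉ S, app Sb0 d k (g k)) →
      (∀ k ∉ S, IE Sb0 (g k) (f k)) → IE Sb0 d (piT n e)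
/-- Inductive version of `NEE`. -/
inductive INE (Sb0 : ℕ → ℕ → ℕ) : ℕ → ℕ → Prop
  | fin (k n) : n ≤ k → INE Sb0 k (nNat n)
  | pl0 (n m k) : IU Sb0 (plT n m) → INE Sb0 k n → INE Sb0 (pair 0 k) (plT n m)
  | pl1 (n m k) : IU Sb0 (plT n m) → INE Sb0 k m → INE Sb0 (pair 1 k) (plT n m)
  | pl2 (n m k) : IU Sb0 (plT n m) → (∀ x : ℕ, k ≠ pair 0 x ∧ k ≠ pair 1 x) →
      INE Sb0 k (plT n m)
  | sig1 (n e k u) : IU Sb0 (sigT n e) → INE Sb0 k n → INE Sb0 (pair k u) (sigT n e)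
  | sig2 (n e k u x) : IU Sb0 (sigT n e) → app Sb0 e k x → INE Sb0 u x →
      INE Sb0 (pair k u) (sigT n e)
  | sig3 (n e z) : IU Sb0 (sigT n e) → (∀ u v : ℕ, z ≠ pair u v) → INE Sb0 z (sigT n e)
  | pi1 (n e d u) : IU Sb0 (piT n e) → IE Sb0 u n → (∀ z : ℕ, ¬ app Sb0 d u z) →
      INE Sb0 d (piT n e)
  | pi2 (n e d u x z) : IU Sb0 (piT n e) → IE Sb0 u n → app Sb0 e u x → app Sb0 d u z →
      INE Sb0 z x → INE Sb0 d (piT n e)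
end

/-- Skolemisation of the disjunctive premises. -/
theorem skolem {A : ℕ → Prop} {B : ℕ → ℕ → Prop} (h : ∀ k, A k ∨ ∃ x, B k x) :
    ∃ f : ℕ → ℕ, ∀ k ∉ {k | A k}, B k (f k) := by
  have : ∀ k, ∃ x, k ∉ {k | A k} → B k x := by
    intro k
    rcases h k with h | ⟨x, h⟩
    · exact ⟨0, fun g => absurd h g⟩
    · exact ⟨x, fun _ => h⟩
  choose f hf using this
  exact ⟨f, hf⟩

/-- A type code whose elements and non-elements are disjoint. -/
def Dj (Sb0 : ℕ → ℕ → ℕ) (n : ℕ) : Prop := ∀ x, IE Sb0 x n → INE Sb0 x n → False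

theorem dj_fin (Sb0 n) : Dj Sb0 (nNat n) := by
  intro x h h'
  generalize ht : nNat n = t at h h'
  cases h <;> simp [nNat, natt, plT, sigT, piT, pair_inj] at ht
  subst ht
  rename_i h
  generalize ht : nNat n = t at h'
  cases h' <;> simp [nNat, natt, plT, sigT, piT, pair_inj] at ht
  omega

theorem dj_nat (Sb0) : Dj Sb0 natt := by
  intro x h h'
  generalize ht : natt = t at h'
  cases h' <;> simp [nNat, natt, plT, sigT, piT, pair_inj] at ht

theorem dj_pl {Sb0 n m} (hn : Dj Sb0 n) (hm : Dj Sb0 m) : Dj Sb0 (plT n m) := by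
  intro x h h'
  have h1 : (∃ k, x = pair 0 k ∧ IE Sb0 k n) ∨ (∃ k, x = pair 1 k ∧ IE Sb0 k m) := by
    generalize ht : plT n m = t at h
    cases h <;> simp [nNat, natt, plT, sigT, piT, pair_inj] at ht <;>
      obtain ⟨rfl, rfl⟩ := ht <;> simp_all [pair_inj]
  have h2 : (∃ k, x = pair 0 k ∧ INE Sb0 k n) ∨ (∃ k, x = pair 1 k ∧ INE Sb0 k m) ∨
      (∀ k : ℕ, x ≠ pair 0 k ∧ x ≠ pair 1 k) := by
    generalize ht : plT n m = t at h'
    cases h' <;> simp [nNat, natt, plT, sigT, piT, pair_inj] at ht <;>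
      obtain ⟨rfl, rfl⟩ := ht <;> simp_all [pair_inj]
  rcases h1 with ⟨k, rfl, hk⟩ | ⟨k, rfl, hk⟩ <;> rcases h2 with ⟨j, hj, g⟩ | ⟨j, hj, g⟩ | g
  · rw [pair_inj] at hj; exact hn k hk (hj.2 ▸ g)
  · simp [pair_inj] at hj
  · exact (g k).1 rfl
  · simp [pair_inj] at hj
  · rw [pair_inj] at hj; exact hm k hk (hj.2 ▸ g)
  · exact (g k).2 rfl

theorem dj_sig {Sb0 n e} (hn : Dj Sb0 n)
    (he : ∀ k, INE Sb0 k n ∨ ∃ x, app Sb0 e k x ∧ Dj Sb0 x) : Dj Sb0 (sigT n e) := by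
  intro z h h'
  have h1 : ∃ k u x, z = pair k u ∧ IE Sb0 k n ∧ app Sb0 e k x ∧ IE Sb0 u x := by
    generalize ht : sigT n e = t at h
    cases h <;> simp [nNat, natt, plT, sigT, piT, pair_inj] at ht
    obtain ⟨rfl, rfl⟩ := ht
    exact ⟨_, _, _, rfl, by assumption, by assumption, by assumption⟩
  have h2 : (∃ k u, z = pair k u ∧ INE Sb0 k n) ∨
      (∃ k u x, z = pair k u ∧ app Sb0 e k x ∧ INE Sb0 u x) ∨ (∀ u v, z ≠ pair u v) := by
    generalize ht : sigT n e = t at h'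
    cases h' <;> simp [nNat, natt, plT, sigT, piT, pair_inj] at ht <;> obtain ⟨rfl, rfl⟩ := ht
    · exact .inl ⟨_, _, rfl, by assumption⟩
    · exact .inr (.inl ⟨_, _, _, rfl, by assumption, by assumption⟩)
    · exact .inr (.inr (by assumption))
  obtain ⟨k, u, x, rfl, hk, hx, hu⟩ := h1
  rcases h2 with ⟨k', u', hp, g⟩ | ⟨k', u', x', hp, g1, g2⟩ | g
  · rw [pair_inj] at hp; exact hn k hk (hp.1 ▸ g)
  · rw [pair_inj] at hp
    obtain ⟨rfl, rfl⟩ := hp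
    obtain rfl := app_fun hx g1
    rcases he k with g | ⟨y, hy, hd⟩
    · exact hn k hk g
    · obtain rfl := app_fun g1 hy
      exact hd u hu g2
  · exact g _ _ rfl

theorem dj_pi {Sb0 n e} (hn : Dj Sb0 n)
    (he : ∀ k, INE Sb0 k n ∨ ∃ x, app Sb0 e k x ∧ Dj Sb0 x) : Dj Sb0 (piT n e) := by
  intro d h h'
  have h1 : ∀ k, INE Sb0 k n ∨ ∃ x y, app Sb0 e k x ∧ app Sb0 d k y ∧ IE Sb0 y x := by
    generalize ht : piT n e = t at h
    cases h <;> simp [nNat, natt, plT, sigT, piT, pair_inj] at ht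
    rename_i S f g a0 a1 a2 a3 a4
    obtain ⟨rfl, rfl⟩ := ht
    intro k
    by_cases hk : k ∈ S
    · exact .inl (a1 k hk)
    · exact .inr ⟨_, _, a2 k hk, a4 k hk, a3 k hk⟩
  have h2 : ∃ u, IE Sb0 u n ∧ ((∀ z, ¬ app Sb0 d u z) ∨
      ∃ x z, app Sb0 e u x ∧ app Sb0 d u z ∧ INE Sb0 z x) := by
    generalize ht : piT n e = t at h'
    cases h' <;> simp [nNat, natt, plT, sigT, piT, pair_inj] at ht <;> obtain ⟨rfl, rfl⟩ := ht
    · exact ⟨_, by assumption, .inl (by assumption)⟩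
    · exact ⟨_, by assumption, .inr ⟨_, _, by assumption, by assumption, by assumption⟩⟩
  obtain ⟨u, hu, h2⟩ := h2
  rcases h1 u with g | ⟨x, y, hx, hy, hxy⟩
  · exact hn u hu g
  rcases h2 with g | ⟨x', z, hx', hz, hne⟩
  · exact g _ hy
  obtain rfl := app_fun hx hx'
  obtain rfl := app_fun hy hz
  rcases he u with g | ⟨w, hw, hd⟩
  · exact hn u hu g
  · obtain rfl := app_fun hx' hw
    exact hd _ hxy hne

/-- The family used for the induction on the generation of `U`. -/
def IFam (Sb0 : ℕ → ℕ → ℕ) : TyFam where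
  U n := IU Sb0 n ∧ Dj Sb0 n
  E := IE Sb0
  NE := INE Sb0
  V _ := True

theorem closed_IFam (Sb0 : ℕ → ℕ → ℕ) : TyClosed Sb0 (IFam Sb0) := by
  refine ⟨fun n => ⟨.fin n, dj_fin _ _⟩, .fin, .fin, ⟨.nat, dj_nat _⟩, .nat,
    fun n m h h' => ⟨.pl _ _ h.1 h'.1, dj_pl h.2 h'.2⟩,
    fun n m k h => .pl0 _ _ _ h.1, fun n m k h => .pl1 _ _ _ h.1,
    fun n m k h => .pl0 _ _ _ h.1, fun n m k h => .pl1 _ _ _ h.1,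
    fun n m k h => .pl2 _ _ _ h.1, ?_,
    fun n e k u x h => .sig _ _ _ _ _ h.1, fun n e k u h => .sig1 _ _ _ _ h.1,
    fun n e k u x h => .sig2 _ _ _ _ _ h.1, fun n e z h => .sig3 _ _ _ h.1, ?_, ?_,
    fun n e d u h => .pi1 _ _ _ _ h.1, fun n e d u x z h => .pi2 _ _ _ _ _ _ h.1,
    fun _ _ _ _ => trivial⟩
  · intro n e h h'
    obtain ⟨f, hf⟩ := skolem h'
    exact ⟨.sig _ _ _ f h.1 (fun k hk => hk) (fun k hk => (hf k hk).1) fun k hk => (hf k hk).2.1,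
      dj_sig h.2 fun k => (h' k).imp id fun ⟨x, a, b⟩ => ⟨x, a, b.2⟩⟩
  · intro n e h h'
    obtain ⟨f, hf⟩ := skolem h'
    exact ⟨.pi _ _ _ f h.1 (fun k hk => hk) (fun k hk => (hf k hk).1) fun k hk => (hf k hk).2.1,
      dj_pi h.2 fun k => (h' k).imp id fun ⟨x, a, b⟩ => ⟨x, a, b.2⟩⟩
  · intro n e d h h'
    obtain ⟨f, hf⟩ := skolem h'
    have : ∀ k, INE Sb0 k n ∨ ∃ y, app Sb0 e k (f k) ∧ app Sb0 d k y ∧ IE Sb0 y (f k) := by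
      intro k
      by_cases hk : INE Sb0 k n
      · exact .inl hk
      · exact .inr (hf k hk)
    obtain ⟨g, hg⟩ := skolem this
    exact .pi _ _ _ _ f g h.1 (fun k hk => hk) (fun k hk => (hg k hk).1)
      (fun k hk => (hg k hk).2.1) fun k hk => (hg k hk).2.2

/-- One direction of Lemma 5.3: for every type `n ∈ U`, elementhood and
non-elementhood are disjoint: no `x` satisfies both `x E n` and `x NE n`. -/
theorem elem_nonelem_disjoint (Sb0 : ℕ → ℕ → ℕ) (n : ℕ) (hn : UU Sb0 n) :
    ∀ x : ℕ, ¬ (EE Sb0 x n ∧ NEE Sb0 x n) := by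
  exact fun x h => (hn _ (closed_IFam Sb0)).2 x (h.1 _ (closed_IFam Sb0)) (h.2 _ (closed_IFam Sb0))
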